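/- For every real μ with 0 < μ < 1, ln(1 − μ) < 9μ / (4(2μ − 3)). -/

import Mathlib

/-- For every real `μ` with `0 < μ < 1`, `ln (1 - μ) < 9μ / (4 (2μ - 3))`. -/
theorem log_lt_M_zero (μ : ℝ) (hμ0 : 0 < μ) (hμ1 : μ < 1) :
    Real.log (1 - μ) < 9 * μ / (4 * (2 * μ - 3)) := by
  have hd : ∀ x : ℝ, x < 1 → HasDerivAt
      (fun x : ℝ => Real.log (1 - x) - 9 * x / (4 * (2 * x - 3)))
      ((-1) / (1 - x) - (9 * 1 * (4 * (2 * x - 3)) - 9 * x * (4 * (2 * 1))) /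
        (4 * (2 * x - 3)) ^ 2) x := by
    intro x hx
    have h1 : (1 - x) ≠ 0 := by linarith
    have h2 : 4 * (2 * x - 3) ≠ 0 := by linarith
    exact (((hasDerivAt_id' x).const_sub 1).log h1).sub
      (((hasDerivAt_id' x).const_mul 9).div
        ((((hasDerivAt_id' x).const_mul 2).sub_const 3).const_mul 4) h2)
  obtain ⟨c, ⟨hc0, hc1⟩, hc⟩ := exists_hasDerivAt_eq_slope _ _ hμ0
    (fun x hx => (hd x (lt_of_le_of_lt hx.2 hμ1)).continuousAt.continuousWithinAt)
    (fun x hx => hd x (lt_trans hx.2 hμ1))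
  have hneg : (-1) / (1 - c) - (9 * 1 * (4 * (2 * c - 3)) - 9 * c * (4 * (2 * 1))) /
        (4 * (2 * c - 3)) ^ 2 < 0 := by
    have h1 : 0 < 1 - c := by linarith
    have h2 : 0 < 3 - 2 * c := by linarith
    have h3 : 2 * c - 3 ≠ 0 := by linarith
    have e : (-1) / (1 - c) - (9 * 1 * (4 * (2 * c - 3)) - 9 * c * (4 * (2 * 1))) /
        (4 * (2 * c - 3)) ^ 2 =
        -((16 * c ^ 2 - 21 * c + 9) / ((1 - c) * (4 * (2 * c - 3) ^ 2))) := by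
      have := h1.ne'
      have h5 : (4 * (2 * c - 3)) ^ 2 ≠ 0 := by positivity
      have h6 : (1 - c) * (4 * (2 * c - 3) ^ 2) ≠ 0 := by positivity
      rw [div_sub_div _ _ this h5, ← neg_div, div_eq_div_iff (mul_ne_zero this h5) h6]
      ring
    rw [e]
    have h4 : 0 < 16 * c ^ 2 - 21 * c + 9 := by nlinarith [sq_nonneg (32 * c - 21)]
    have : 0 < (16 * c ^ 2 - 21 * c + 9) / ((1 - c) * (4 * (2 * c - 3) ^ 2)) := by positivity
    linarith
  rw [hc, div_neg_iff] at hneg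
  norm_num at hneg
  rcases hneg with h | h <;> linarith [h.1, h.2]
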